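/- Let ρ be a c-compatible irreducible representation of ℂl(V) on a finite-dimensional complex vector space K with Krein product (·,·), and let ω = e₁⋯e_n be a volume element of ℂl(V). (1) If n ≡ 2 or 6 (mod 8), then Q has Lorentzian signature (n−1, 1) if and only if there exists v ∈ V, with ωv invertible, such that the hermitian form (ψ,φ)_v := (ψ, ρ(ωv)⁻¹φ) is definite. (2) If n ≡ 0 or 4 (mod 8), then Q is Lorentzian if and only if there exists v ∈ V such that (ψ,φ)_v := (ψ, iρ(ωv)⁻¹φ) is definite. Moreover, when Q is Lorentzian, with open light cone C := {v ∈ V : Q(v) < 0} and its two connected components C₊ and C₋: for every v ∈ V with Q(v) ≠ 0, (·,·)_v is definite if and only if v ∈ C, and there exists a sign λ ∈ {+1, −1} such that for v ∈ C, λ(·,·)_v is positive definite if and only if v ∈ C₊ and negative definite if and only if v ∈ C₋. -/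

import Mathlib

noncomputable section

open TensorProduct

variable {V : Type*} [AddCommGroup V] [Module ℝ V]

/-- `ℂl(V)`: the complexified Clifford algebra of `(V, Q)` (convention `v² = Q(v)·1`). -/
abbrev CCl (Q : QuadraticForm ℝ V) := CliffordAlgebra (Q.baseChange ℂ)

/-- The canonical embedding of the real vector space `V` into `ℂl(V)`. -/
def ιr (Q : QuadraticForm ℝ V) (v : V) : CCl Q :=
  CliffordAlgebra.ι (Q.baseChange ℂ) ((1 : ℂ) ⊗ₜ[ℝ] v)

/-- `V^ℂ`: the complexification of `V`, sitting inside `ℂl(V)`. -/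
def VC (Q : QuadraticForm ℝ V) : Submodule ℂ (CCl Q) :=
  LinearMap.range (CliffordAlgebra.ι (Q.baseChange ℂ))

/-- A real structure on `ℂl(V)`: an involutive conjugate-linear algebra automorphism
stabilizing `V^ℂ`. -/
structure RealStructure (Q : QuadraticForm ℝ V) where
  toFun : CCl Q → CCl Q
  map_add' : ∀ x y, toFun (x + y) = toFun x + toFun y
  map_mul' : ∀ x y, toFun (x * y) = toFun x * toFun y
  map_smul' : ∀ (z : ℂ) (x : CCl Q), toFun (z • x) = (starRingEnd ℂ z) • toFun x
  map_one' : toFun 1 = 1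
  invol : ∀ x, toFun (toFun x) = x
  stable : ∀ x ∈ VC Q, toFun x ∈ VC Q

namespace RealStructure

theorem map_zero' {Q : QuadraticForm ℝ V} (σ : RealStructure Q) : σ.toFun 0 = 0 := by
  have h := σ.map_smul' 0 0
  simpa using h

end RealStructure

/-- The fixed points of a real structure, as a real submodule of `ℂl(V)`. -/
def fixedPoints {Q : QuadraticForm ℝ V} (σ : RealStructure Q) : Submodule ℝ (CCl Q) where
  carrier := {x | σ.toFun x = x}
  add_mem' := by
    intro a b ha hb
    simp only [Set.mem_setOf_eq] at *
    rw [σ.map_add', ha, hb]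
  zero_mem' := σ.map_zero'
  smul_mem' := by
    intro r x hx
    simp only [Set.mem_setOf_eq] at *
    rw [← Complex.coe_smul, σ.map_smul', hx]
    simp [Complex.conj_ofReal]

/-- `V_σ = {w ∈ V^ℂ : σ(w) = w}`, as a real submodule of `ℂl(V)`. -/
def VFix {Q : QuadraticForm ℝ V} (σ : RealStructure Q) : Submodule ℝ (CCl Q) :=
  (VC Q).restrictScalars ℝ ⊓ fixedPoints σ

/-- Multiplication by `i`, as a real-linear endomorphism of `ℂl(V)`. -/
def mulI (Q : QuadraticForm ℝ V) : CCl Q →ₗ[ℝ] CCl Q where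
  toFun x := Complex.I • x
  map_add' x y := smul_add _ x y
  map_smul' r x := smul_comm Complex.I r x

/-- The real subspace `V ⊆ V^ℂ ⊆ ℂl(V)`. -/
def Vreal (Q : QuadraticForm ℝ V) : Submodule ℝ (CCl Q) :=
  Submodule.span ℝ (Set.range (ιr Q))

/-- The canonical real structure `c` (characterized by fixing `V` pointwise). -/
def IsCanonicalC {Q : QuadraticForm ℝ V} (c : RealStructure Q) : Prop :=
  ∀ v : V, c.toFun (ιr Q v) = ιr Q v

/-- `σ` is admissible iff it commutes with the canonical real structure `c`. -/
def Admissible {Q : QuadraticForm ℝ V} (c σ : RealStructure Q) : Prop :=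
  ∀ x, σ.toFun (c.toFun x) = c.toFun (σ.toFun x)

/-- Nondegeneracy of a real quadratic form, via its polar form. -/
def QFNondeg (Q : QuadraticForm ℝ V) : Prop :=
  ∀ v : V, (∀ w : V, QuadraticMap.polar Q v w = 0) → v = 0

/-- A hermitian sesquilinear form (conjugate-linear in the first argument). -/
structure SesqForm (K : Type*) [AddCommGroup K] [Module ℂ K] where
  form : K → K → ℂ
  add_left : ∀ x y z : K, form (x + y) z = form x z + form y z
  add_right : ∀ x y z : K, form x (y + z) = form x y + form x z
  smul_left : ∀ (a : ℂ) (x y : K), form (a • x) y = starRingEnd ℂ a * form x y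
  smul_right : ∀ (a : ℂ) (x y : K), form x (a • y) = a * form x y
  herm : ∀ x y : K, form y x = starRingEnd ℂ (form x y)

section KreinDefs

variable {K : Type*} [AddCommGroup K] [Module ℂ K]

/-- Nondegeneracy: a nondegenerate hermitian form is a Krein product. -/
def SesqForm.Nondeg (h : SesqForm K) : Prop :=
  ∀ x : K, (∀ y : K, h.form x y = 0) → x = 0

/-- Positive definiteness of a sesquilinear form. -/
def FPosDef (f : K → K → ℂ) : Prop := ∀ x : K, x ≠ 0 → ∃ r : ℝ, 0 < r ∧ f x x = r

/-- Negative definiteness of a sesquilinear form. -/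
def FNegDef (f : K → K → ℂ) : Prop := ∀ x : K, x ≠ 0 → ∃ r : ℝ, r < 0 ∧ f x x = r

/-- Definiteness of a sesquilinear form. -/
def FDefinite (f : K → K → ℂ) : Prop := FPosDef f ∨ FNegDef f

/-- `f` is neutral: it admits an orthogonal decomposition into a positive definite
and a negative definite part of equal dimensions (equal indices of inertia). -/
def FNeutral (f : K → K → ℂ) : Prop :=
  ∃ P N : Submodule ℂ K, P ⊓ N = ⊥ ∧ P ⊔ N = ⊤
    ∧ (∀ x ∈ P, ∀ y ∈ N, f x y = 0)
    ∧ (∀ x ∈ P, x ≠ 0 → ∃ r : ℝ, 0 < r ∧ f x x = r)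
    ∧ (∀ y ∈ N, y ≠ 0 → ∃ r : ℝ, r < 0 ∧ f y y = r)
    ∧ Module.finrank ℂ P = Module.finrank ℂ N

end KreinDefs

section Rep

variable {V : Type*} [AddCommGroup V] [Module ℝ V]
variable {Q : QuadraticForm ℝ V} {K : Type*} [AddCommGroup K] [Module ℂ K]

/-- σ-compatibility of a representation with a hermitian form:
`(ρ(a)ψ, φ) = (ψ, ρ(a^{×_σ})φ)` where `a^{×_σ} = σ(aᵀ)`. -/
def Compat (σ : RealStructure Q) (ρ : CCl Q →ₐ[ℂ] Module.End ℂ K)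
    (h : SesqForm K) : Prop :=
  ∀ (a : CCl Q) (ψ φ : K),
    h.form (ρ a ψ) φ = h.form ψ (ρ (σ.toFun (CliffordAlgebra.reverse a)) φ)

/-- Irreducibility of a representation: `K` is a simple module. -/
def IsIrreducibleRep (ρ : CCl Q →ₐ[ℂ] Module.End ℂ K) : Prop :=
  (∃ x : K, x ≠ 0) ∧
    ∀ p : Submodule ℂ K, (∀ a : CCl Q, ∀ x ∈ p, ρ a x ∈ p) → p = ⊥ ∨ p = ⊤

end Rep

section Signature

variable {V : Type*} [AddCommGroup V] [Module ℝ V]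

/-- `Q` has signature `(p, q)`: there is a pseudo-orthonormal basis with `p` vectors of
square `+1` and `q` vectors of square `−1`. -/
def HasSignature (Q : QuadraticForm ℝ V) (p q : ℕ) : Prop :=
  ∃ e : Fin (p + q) → V,
    LinearIndependent ℝ e ∧ Submodule.span ℝ (Set.range e) = ⊤
    ∧ (∀ i j, i ≠ j → QuadraticMap.polar Q (e i) (e j) = 0)
    ∧ (∀ i : Fin (p + q), (i : ℕ) < p → Q (e i) = 1)
    ∧ (∀ i : Fin (p + q), p ≤ (i : ℕ) → Q (e i) = -1)

/-- `v` and `w` can be joined by a segment staying in `{Q > 0}` (same component of the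
open light cone, anti-Lorentzian convention). -/
def SameConePos (Q : QuadraticForm ℝ V) (v w : V) : Prop :=
  ∀ t : ℝ, 0 ≤ t → t ≤ 1 → 0 < Q ((1 - t) • v + t • w)

/-- `Cp`, `Cn` are the two connected components of the open cone `{Q > 0}`. -/
def IsConeComponentsPos (Q : QuadraticForm ℝ V) (Cp Cn : Set V) : Prop :=
  Cp ∪ Cn = {v | 0 < Q v} ∧ Cp ∩ Cn = ∅ ∧ Cp.Nonempty ∧ Cn.Nonempty
  ∧ (∀ v ∈ Cp, ∀ w ∈ Cp, SameConePos Q v w)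
  ∧ (∀ v ∈ Cn, ∀ w ∈ Cn, SameConePos Q v w)
  ∧ (∀ v ∈ Cp, ∀ w ∈ Cn, ¬ SameConePos Q v w)

/-- `v` and `w` can be joined by a segment staying in `{Q < 0}` (same component of the
open light cone, Lorentzian convention). -/
def SameConeNeg (Q : QuadraticForm ℝ V) (v w : V) : Prop :=
  ∀ t : ℝ, 0 ≤ t → t ≤ 1 → Q ((1 - t) • v + t • w) < 0

/-- `Cp`, `Cn` are the two connected components of the open cone `{Q < 0}`. -/
def IsConeComponentsNeg (Q : QuadraticForm ℝ V) (Cp Cn : Set V) : Prop :=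
  Cp ∪ Cn = {v | Q v < 0} ∧ Cp ∩ Cn = ∅ ∧ Cp.Nonempty ∧ Cn.Nonempty
  ∧ (∀ v ∈ Cp, ∀ w ∈ Cp, SameConeNeg Q v w)
  ∧ (∀ v ∈ Cn, ∀ w ∈ Cn, SameConeNeg Q v w)
  ∧ (∀ v ∈ Cp, ∀ w ∈ Cn, ¬ SameConeNeg Q v w)

end Signature

section QuadraticFormBasics

/-- `v` is a negative vector whose orthogonal complement is positive definite. -/
def IsTimeDirection (Q : QuadraticForm ℝ V) (v : V) : Prop :=
  Q v < 0 ∧ ∀ u, u ≠ 0 → QuadraticMap.polar Q v u = 0 → 0 < Q u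

theorem quadraticForm_sum_of_orthogonal (Q : QuadraticForm ℝ V) {ι : Type*} (e : ι → V)
    (he : ∀ i j, i ≠ j → QuadraticMap.polar Q (e i) (e j) = 0) (a : ι → ℝ) (s : Finset ι) :
    Q (∑ i ∈ s, a i • e i) = ∑ i ∈ s, a i * a i * Q (e i) := by
  classical
  induction s using Finset.induction_on with
  | empty => simp
  | insert i s hi ih =>
    rw [Finset.sum_insert hi, Finset.sum_insert hi, QuadraticMap.map_add Q, ih, QuadraticMap.map_smul]
    have : QuadraticMap.polar Q (a i • e i) (∑ j ∈ s, a j • e j) = 0 := by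
      rw [← QuadraticMap.polarBilin_apply_apply, map_sum]
      refine Finset.sum_eq_zero fun j hj => ?_
      have hij : i ≠ j := by rintro rfl; exact hi hj
      simp [he i j hij]
    rw [this, add_zero, smul_eq_mul]

theorem HasSignature.exists_isTimeDirection {Q : QuadraticForm ℝ V} {p : ℕ}
    (hs : HasSignature Q p 1) : ∃ v, IsTimeDirection Q v := by
  obtain ⟨f, -, hspan, horth, hpos, hneg⟩ := hs
  have hlast : Q (f (Fin.last p)) = -1 := hneg _ (by simp)
  refine ⟨f (Fin.last p), by rw [hlast]; norm_num, fun u hu hvu => ?_⟩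
  obtain ⟨a, rfl⟩ := (Submodule.mem_span_range_iff_exists_fun ℝ).1
    (hspan ▸ Submodule.mem_top : u ∈ Submodule.span ℝ (Set.range f))
  have ha : a (Fin.last p) = 0 := by
    rw [← QuadraticMap.polarBilin_apply_apply, map_sum, Finset.sum_eq_single (Fin.last p)] at hvu
    · simpa [hlast, QuadraticMap.polar_self] using hvu
    · intro j _ hj
      simp [horth _ _ hj.symm]
    · simp
  have hterm : ∀ j, j ≠ Fin.last p → Q (f j) = 1 := fun j hj =>
    hpos j (Fin.val_lt_last hj)
  rw [quadraticForm_sum_of_orthogonal Q f horth]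
  have hex : ∃ j, a j ≠ 0 := by
    by_contra! hall
    exact hu (by simp [hall])
  obtain ⟨j, hj⟩ := hex
  refine Finset.sum_pos' (fun i _ => ?_) ⟨j, Finset.mem_univ j, ?_⟩
  · by_cases hi : i = Fin.last p
    · simp [hi, ha]
    · rw [hterm i hi, mul_one]
      exact mul_self_nonneg _
  · have hjl : j ≠ Fin.last p := by rintro rfl; exact hj ha
    rw [hterm j hjl, mul_one]
    exact mul_self_pos.2 hj

theorem IsTimeDirection.exists_unique_negative {Q : QuadraticForm ℝ V} {v : V}
    (hv : IsTimeDirection Q v) {n : ℕ} (e : Fin n → V)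
    (he_span : Submodule.span ℝ (Set.range e) = ⊤)
    (he_orth : ∀ i j, i ≠ j → QuadraticMap.polar Q (e i) (e j) = 0)
    (he_unit : ∀ i, Q (e i) = 1 ∨ Q (e i) = -1) :
    ∃ i₀, Q (e i₀) = -1 ∧ ∀ j, j ≠ i₀ → Q (e j) = 1 := by
  have hneg : ∀ u, QuadraticMap.polar Q v u = 0 → ¬ Q u < 0 := fun u hu hlt => by
    have hu0 : u ≠ 0 := by rintro rfl; simp at hlt
    exact lt_asymm hlt (hv.2 u hu0 hu)
  have hex : ∃ i₀, Q (e i₀) = -1 := by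
    by_contra! hall
    obtain ⟨a, ha⟩ := (Submodule.mem_span_range_iff_exists_fun ℝ).1
      (he_span ▸ Submodule.mem_top : v ∈ Submodule.span ℝ (Set.range e))
    have h1 := hv.1
    rw [← ha, quadraticForm_sum_of_orthogonal Q e he_orth] at h1
    refine absurd h1 (not_lt.2 (Finset.sum_nonneg fun i _ => ?_))
    rw [(he_unit i).resolve_right (hall i), mul_one]
    exact mul_self_nonneg _
  obtain ⟨i, hi⟩ := hex
  refine ⟨i, hi, fun j hj => (he_unit j).resolve_right fun hj1 => ?_⟩
  set a := QuadraticMap.polar Q v (e j)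
  set b := QuadraticMap.polar Q v (e i)
  have hQ : Q (a • e i - b • e j) = -(a * a + b * b) := by
    rw [sub_eq_add_neg, ← neg_smul, QuadraticMap.map_add Q, QuadraticMap.map_smul,
      QuadraticMap.map_smul, QuadraticMap.polar_smul_left, QuadraticMap.polar_smul_right,
      he_orth i j hj.symm, hi, hj1]
    simp only [smul_eq_mul]
    ring
  have hp : QuadraticMap.polar Q v (a • e i - b • e j) = 0 := by
    rw [QuadraticMap.polar_sub_right, QuadraticMap.polar_smul_right,
      QuadraticMap.polar_smul_right]
    simp only [smul_eq_mul, a, b]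
    ring
  have h1 := hneg _ hp
  rw [hQ] at h1
  have hb : b = 0 := by nlinarith [mul_self_nonneg a, mul_self_nonneg b]
  exact hneg (e i) hb (by rw [hi]; norm_num)

theorem hasSignature_of_unique_negative {Q : QuadraticForm ℝ V} {n : ℕ} (e : Fin n → V)
    (he_indep : LinearIndependent ℝ e)
    (he_span : Submodule.span ℝ (Set.range e) = ⊤)
    (he_orth : ∀ i j, i ≠ j → QuadraticMap.polar Q (e i) (e j) = 0)
    (i₀ : Fin n) (h₀ : Q (e i₀) = -1) (h₁ : ∀ j, j ≠ i₀ → Q (e j) = 1) :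
    HasSignature Q (n - 1) 1 := by
  cases n with
  | zero => exact i₀.elim0
  | succ p =>
    have key : HasSignature Q p 1 := by
      let σ : Equiv.Perm (Fin (p + 1)) := Equiv.swap i₀ (Fin.last p)
      have hσ : σ (Fin.last p) = i₀ := Equiv.swap_apply_right _ _
      refine ⟨e ∘ σ, he_indep.comp _ σ.injective, ?_, ?_, ?_, ?_⟩
      · rw [σ.surjective.range_comp, he_span]
      · intro i j hij
        exact he_orth _ _ fun hc => hij (σ.injective hc)
      · intro i hi
        refine h₁ _ fun hc => ?_
        rw [← hσ] at hc
        rw [σ.injective hc] at hi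
        simp at hi
      · intro i hi
        have : i = Fin.last p := Fin.ext (le_antisymm (Nat.lt_succ_iff.1 i.2) hi)
        rw [this]
        simpa [hσ] using h₀
    exact key

end QuadraticFormBasics

section AnticommutingProducts

variable {A : Type*} [Ring A]

theorem list_prod_mul_of_anticommute {ι : Type*} [DecidableEq ι] (x : ι → A)
    (hx : ∀ i j, i ≠ j → x i * x j = -(x j * x i)) (i : ι) (l : List ι) (hl : l.Nodup) :
    (l.map x).prod * x i
      = (-1) ^ (l.length + if i ∈ l then 1 else 0) * (x i * (l.map x).prod) := by
  induction l with
  | nil => simp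
  | cons j l ih =>
    rw [List.nodup_cons] at hl
    rw [List.map_cons, List.prod_cons, mul_assoc, ih hl.2]
    by_cases hij : i = j
    · subst hij
      rw [if_neg hl.1, if_pos List.mem_cons_self, List.length_cons]
      have hc : Commute (x i) ((-1 : A) ^ (l.length + 0)) := (Commute.neg_one_right _).pow_right _
      rw [← mul_assoc, hc.eq, mul_assoc]
      congr 1
      rw [add_zero, add_assoc, pow_add]
      norm_num
    · have hmem : (i ∈ j :: l) ↔ i ∈ l := by simp [hij]
      simp only [hmem, List.length_cons]
      set m := l.length + if i ∈ l then 1 else 0 with hm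
      have hc : Commute (x j) ((-1 : A) ^ m) := (Commute.neg_one_right _).pow_right _
      rw [← mul_assoc, hc.eq, add_right_comm, ← hm, pow_succ, mul_assoc, ← mul_assoc (x j),
        hx j i (Ne.symm hij)]
      noncomm_ring

theorem list_reverse_prod_of_anticommute {ι : Type*} [DecidableEq ι] (x : ι → A)
    (hx : ∀ i j, i ≠ j → x i * x j = -(x j * x i)) (l : List ι) (hl : l.Nodup) :
    (l.map x).reverse.prod = (-1) ^ (l.length.choose 2) * (l.map x).prod := by
  induction l with
  | nil => simp
  | cons j l ih =>
    rw [List.nodup_cons] at hl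
    rw [List.map_cons, List.reverse_cons, List.prod_append, List.prod_singleton, ih hl.2,
      mul_assoc, list_prod_mul_of_anticommute x hx j l hl.2, if_neg hl.1, ← mul_assoc, ← pow_add,
      List.prod_cons, List.length_cons, Nat.choose_succ_succ' l.length 1, Nat.choose_one_right,
      add_zero, add_comm (l.length.choose 2)]

theorem list_prod_mul_reverse_prod {l : List A} (hl : ∀ a ∈ l, a * a = 1 ∨ a * a = -1) :
    l.prod * l.reverse.prod = 1 ∨ l.prod * l.reverse.prod = -1 := by
  induction l with
  | nil => simp
  | cons a l ih =>
    have h1 := ih fun b hb => hl b (List.mem_cons_of_mem _ hb)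
    have h2 := hl a List.mem_cons_self
    have h3 : (a :: l).prod * (a :: l).reverse.prod = a * (l.prod * l.reverse.prod) * a := by
      simp [mul_assoc]
    rw [h3]
    rcases h1 with h1 | h1 <;> rcases h2 with h2 | h2 <;> simp [h1, h2]

end AnticommutingProducts

section Definiteness

variable {K : Type*} [AddCommGroup K]

theorem fPosDef_iff {f : K → K → ℂ} {q : K → ℝ} (hf : ∀ x, f x x = q x) :
    FPosDef f ↔ ∀ x, x ≠ 0 → 0 < q x := by
  refine forall₂_congr fun x _ => ⟨?_, fun hx => ⟨q x, hx, hf x⟩⟩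
  rintro ⟨r, hr, hfr⟩
  rw [hf, Complex.ofReal_inj] at hfr
  rwa [hfr]

theorem fNegDef_iff {f : K → K → ℂ} {q : K → ℝ} (hf : ∀ x, f x x = q x) :
    FNegDef f ↔ ∀ x, x ≠ 0 → q x < 0 := by
  refine forall₂_congr fun x _ => ⟨?_, fun hx => ⟨q x, hx, hf x⟩⟩
  rintro ⟨r, hr, hfr⟩
  rw [hf, Complex.ofReal_inj] at hfr
  rwa [hfr]

theorem fDefinite_iff {f : K → K → ℂ} {q : K → ℝ} (hf : ∀ x, f x x = q x) :
    FDefinite f ↔ (∀ x, x ≠ 0 → 0 < q x) ∨ ∀ x, x ≠ 0 → q x < 0 := by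
  rw [FDefinite, fPosDef_iff hf, fNegDef_iff hf]

end Definiteness

section HermitianForms

variable {K : Type*} [AddCommGroup K] [Module ℂ K]

namespace SesqForm

theorem zero_right (g : SesqForm K) (x : K) : g.form x 0 = 0 := by
  simpa using g.smul_right 0 x 0

theorem zero_left (g : SesqForm K) (x : K) : g.form 0 x = 0 := by
  simpa using g.smul_left 0 0 x

theorem neg_right (g : SesqForm K) (x y : K) : g.form x (-y) = -g.form x y := by
  simpa using g.smul_right (-1) x y

theorem im_self (g : SesqForm K) (x : K) : (g.form x x).im = 0 :=
  Complex.conj_eq_iff_im.1 (g.herm x x).symm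

/-- `φ ↦ (i ↦ (b i, φ))` as a linear map. -/
def coord (g : SesqForm K) {ι : Type*} (b : ι → K) : K →ₗ[ℂ] (ι → ℂ) where
  toFun φ i := g.form (b i) φ
  map_add' _ _ := by ext i; exact g.add_right _ _ _
  map_smul' _ _ := by ext i; exact g.smul_right _ _ _

/-- `ψ ↦ (φ, ψ)` as a linear functional. -/
def functional (g : SesqForm K) (φ : K) : K →ₗ[ℂ] ℂ where
  toFun ψ := g.form φ ψ
  map_add' _ _ := g.add_right _ _ _
  map_smul' _ _ := g.smul_right _ _ _

theorem eq_of_eq_on_basis (g g' : SesqForm K) {ι : Type*} (b : Module.Basis ι ℂ K) (a : ℂ)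
    (φ : K) (hb : ∀ i, g.form (b i) φ = a * g'.form (b i) φ) (ψ : K) :
    g.form ψ φ = a * g'.form ψ φ := by
  have : g.functional φ = (starRingEnd ℂ a) • g'.functional φ := by
    refine b.ext fun i => ?_
    change g.form φ (b i) = starRingEnd ℂ a * g'.form φ (b i)
    rw [g.herm (b i) φ, g'.herm (b i) φ, hb i, map_mul]
  have h1 : g.form φ ψ = starRingEnd ℂ a * g'.form φ ψ := LinearMap.congr_fun this ψ
  rw [g.herm φ ψ, g'.herm φ ψ, h1, map_mul, Complex.conj_conj]

/-- The standard hermitian form attached to a basis. -/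
def ofBasis {ι : Type*} [Fintype ι] (b : Module.Basis ι ℂ K) : SesqForm K where
  form x y := ∑ i, starRingEnd ℂ (b.repr x i) * b.repr y i
  add_left x y z := by simp [add_mul, Finset.sum_add_distrib]
  add_right x y z := by simp [mul_add, Finset.sum_add_distrib]
  smul_left a x y := by simp [Finset.mul_sum, mul_assoc]
  smul_right a x y := by simp [Finset.mul_sum, mul_left_comm]
  herm x y := by simp [mul_comm]

theorem ofBasis_pos {ι : Type*} [Fintype ι] (b : Module.Basis ι ℂ K) (x : K) (hx : x ≠ 0) :
    0 < ((ofBasis b).form x x).re := by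
  have hre : ((ofBasis b).form x x).re = ∑ i, Complex.normSq (b.repr x i) := by
    simp only [ofBasis, Complex.re_sum]
    refine Finset.sum_congr rfl fun i _ => ?_
    rw [mul_comm, Complex.mul_conj, Complex.ofReal_re]
  rw [hre]
  have hex : ∃ i, b.repr x i ≠ 0 := by
    by_contra! hall
    exact hx (b.repr.map_eq_zero_iff.1 (Finsupp.ext hall))
  obtain ⟨i, hi⟩ := hex
  exact Finset.sum_pos' (fun _ _ => Complex.normSq_nonneg _)
    ⟨i, Finset.mem_univ i, Complex.normSq_pos.2 hi⟩

/-- The sum of a form and its pullback along a linear map. -/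
def addPullback (g : SesqForm K) (T : K →ₗ[ℂ] K) : SesqForm K where
  form x y := g.form x y + g.form (T x) (T y)
  add_left x y z := by rw [map_add, g.add_left, g.add_left]; ring
  add_right x y z := by rw [map_add, g.add_right, g.add_right]; ring
  smul_left a x y := by rw [map_smul, g.smul_left, g.smul_left]; ring
  smul_right a x y := by rw [map_smul, g.smul_right, g.smul_right]; ring
  herm x y := by rw [map_add, ← g.herm, ← g.herm]

theorem exists_invariant_posDef [FiniteDimensional ℂ K] {ι : Type*} [DecidableEq ι]
    (T : ι → K →ₗ[ℂ] K) (hanti : ∀ i j, i ≠ j → ∀ x, T i (T j x) = -T j (T i x))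
    (hsq : ∀ i, (∀ x, T i (T i x) = x) ∨ ∀ x, T i (T i x) = -x) (s : Finset ι) :
    ∃ g : SesqForm K, (∀ x, x ≠ 0 → 0 < (g.form x x).re) ∧
      ∀ i ∈ s, ∀ x y, g.form (T i x) (T i y) = g.form x y := by
  have hnn : ∀ (g : SesqForm K) (x y : K), g.form (-x) (-y) = g.form x y := fun g x y => by
    rw [← neg_one_smul ℂ x, ← neg_one_smul ℂ y, g.smul_left, g.smul_right]
    simp
  induction s using Finset.induction_on with
  | empty => exact ⟨ofBasis (Module.finBasis ℂ K), ofBasis_pos _, by simp⟩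
  | insert j s hj ih =>
    obtain ⟨g, hg, hinv⟩ := ih
    refine ⟨g.addPullback (T j), fun x hx => ?_, fun i hi x y => ?_⟩
    · have h1 : 0 ≤ (g.form (T j x) (T j x)).re := by
        by_cases h0 : T j x = 0
        · rw [h0, g.zero_left, Complex.zero_re]
        · exact (hg _ h0).le
      exact add_pos_of_pos_of_nonneg (hg x hx) h1
    · change g.form (T i x) (T i y) + g.form (T j (T i x)) (T j (T i y))
        = g.form x y + g.form (T j x) (T j y)
      by_cases hij : i = j
      · subst hij
        rcases hsq i with h1 | h1
        · rw [h1, h1, add_comm]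
        · rw [h1, h1, hnn, add_comm]
      · have his := Finset.mem_of_mem_insert_of_ne hi hij
        rw [hinv i his, hanti j i (Ne.symm hij), hanti j i (Ne.symm hij), hnn, hinv i his]

/-- Two hermitian forms, the second positive definite, agree up to a scalar on some nonzero
vector. -/
theorem exists_proportional_vector [FiniteDimensional ℂ K] [Nontrivial K] (f g : SesqForm K)
    (hg : ∀ x, x ≠ 0 → 0 < (g.form x x).re) :
    ∃ (a : ℂ) (φ : K), φ ≠ 0 ∧ ∀ ψ, f.form ψ φ = a * g.form ψ φ := by
  let b := Module.finBasis ℂ K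
  have hinj : Function.Injective (g.coord b) := by
    rw [← LinearMap.ker_eq_bot, LinearMap.ker_eq_bot']
    intro φ hφ
    by_contra h0
    have h1 : g.form φ φ = 0 * g.form φ φ :=
      eq_of_eq_on_basis g g b 0 φ (fun i => by rw [zero_mul]; exact congrFun hφ i) φ
    have h2 := hg φ h0
    rw [h1] at h2
    simp at h2
  let G := LinearEquiv.ofInjectiveOfFinrankEq (g.coord b) hinj (by simp)
  obtain ⟨a, ha⟩ := Module.End.exists_eigenvalue (G.symm.toLinearMap ∘ₗ f.coord b)
  obtain ⟨φ, hφ⟩ := ha.exists_hasEigenvector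
  refine ⟨a, φ, hφ.2, eq_of_eq_on_basis f g b a φ fun i => ?_⟩
  have h1 : G.symm (f.coord b φ) = a • φ := hφ.apply_eq_smul
  rw [LinearEquiv.symm_apply_eq] at h1
  have h2 : f.coord b φ = a • g.coord b φ := by rw [h1, map_smul]; rfl
  exact congrFun h2 i

end SesqForm

end HermitianForms

section CliffordActions

variable {K : Type*} [AddCommGroup K] [Module ℂ K]

/-- A self-adjoint irreducible Clifford action `γ` on `K`, with an operator `Ω` that anticommutes
with it, has square `τ = ±1`, and for which `κ (·, Ω γ(v) ·)` is hermitian. -/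
structure CliffordPairing (Q : QuadraticForm ℝ V) (h : SesqForm K) (γ : V → K →ₗ[ℂ] K)
    (Ω : K →ₗ[ℂ] K) (κ : ℂ) (τ : ℝ) : Prop where
  map_add : ∀ v w x, γ (v + w) x = γ v x + γ w x
  map_smul : ∀ (r : ℝ) v x, γ (r • v) x = (r : ℂ) • γ v x
  sq : ∀ v x, γ v (γ v x) = (Q v : ℂ) • x
  swap : ∀ v w x, γ v (γ w x) = ((QuadraticMap.polar Q v w : ℝ) : ℂ) • x - γ w (γ v x)
  selfAdj : ∀ v x y, h.form (γ v x) y = h.form x (γ v y)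
  irred : ∀ p : Submodule ℂ K, (∀ v, ∀ x ∈ p, γ v x ∈ p) → p = ⊥ ∨ p = ⊤
  nondeg : h.Nondeg
  omega_anti : ∀ v x, Ω (γ v x) = -γ v (Ω x)
  omega_sq : ∀ x, Ω (Ω x) = (τ : ℂ) • x
  tau_eq : τ = 1 ∨ τ = -1
  kappa_ne : κ ≠ 0
  pairing_herm : ∀ v x y, κ * h.form y (Ω (γ v x))
    = starRingEnd ℂ (κ * h.form x (Ω (γ v y)))

namespace CliffordPairing

variable {Q : QuadraticForm ℝ V} {h : SesqForm K} {γ : V → K →ₗ[ℂ] K}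
  {Ω : K →ₗ[ℂ] K} {κ : ℂ} {τ : ℝ}

/-- The hermitian form `κ (·, Ω γ(v) ·)`. -/
def pairing (D : CliffordPairing Q h γ Ω κ τ) (v : V) : SesqForm K where
  form x y := κ * h.form x (Ω (γ v y))
  add_left x y z := by rw [h.add_left, mul_add]
  add_right x y z := by rw [LinearMap.map_add, LinearMap.map_add, h.add_right, mul_add]
  smul_left a x y := by rw [h.smul_left]; ring
  smul_right a x y := by rw [LinearMap.map_smul, LinearMap.map_smul, h.smul_right]; ring
  herm x y := D.pairing_herm v x y

theorem pairing_form (D : CliffordPairing Q h γ Ω κ τ) (v : V) (x y : K) :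
    (D.pairing v).form x y = κ * h.form x (Ω (γ v y)) := rfl

/-- The real quadratic form of `pairing`. -/
def energy (D : CliffordPairing Q h γ Ω κ τ) (v : V) (x : K) : ℝ := ((D.pairing v).form x x).re

theorem pairing_self (D : CliffordPairing Q h γ Ω κ τ) (v : V) (x : K) :
    (D.pairing v).form x x = D.energy v x :=
  Complex.ext rfl (by rw [Complex.ofReal_im]; exact (D.pairing v).im_self x)

theorem pairing_map (D : CliffordPairing Q h γ Ω κ τ) (v u : V) (x y : K) :
    (D.pairing u).form (γ v x) (γ v y)
      = -((QuadraticMap.polar Q v u : ℝ) : ℂ) * (D.pairing v).form x y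
        + (Q v : ℂ) * (D.pairing u).form x y := by
  have h1 : γ v (Ω (γ u (γ v y))) =
      -((QuadraticMap.polar Q v u : ℝ) : ℂ) • Ω (γ v y) + (Q v : ℂ) • Ω (γ u y) := by
    have h2 : γ v (Ω (γ u (γ v y))) = -Ω (γ v (γ u (γ v y))) := by
      rw [D.omega_anti v, neg_neg]
    rw [h2, D.swap v u (γ v y), D.sq, LinearMap.map_sub, LinearMap.map_smul, LinearMap.map_smul,
      LinearMap.map_smul]
    module
  rw [pairing_form, D.selfAdj, h1, h.add_right, h.smul_right, h.smul_right, pairing_form,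
    pairing_form]
  ring

theorem energy_map (D : CliffordPairing Q h γ Ω κ τ) (v u : V) (x : K) :
    D.energy u (γ v x)
      = -QuadraticMap.polar Q v u * D.energy v x + Q v * D.energy u x := by
  have h1 := D.pairing_map v u x x
  rw [pairing_self, pairing_self, pairing_self] at h1
  exact_mod_cast h1

theorem energy_zero (D : CliffordPairing Q h γ Ω κ τ) (v : V) : D.energy v 0 = 0 := by
  rw [energy, SesqForm.zero_left, Complex.zero_re]

theorem polar_eq_zero_of_map_eq_zero [Nontrivial K] (D : CliffordPairing Q h γ Ω κ τ) {u : V}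
    (hu : ∀ x, γ u x = 0) (w : V) : QuadraticMap.polar Q u w = 0 := by
  obtain ⟨x, hx⟩ := exists_ne (0 : K)
  have h1 := D.swap u w x
  rw [hu, hu, LinearMap.map_zero, sub_zero, eq_comm, smul_eq_zero] at h1
  exact_mod_cast h1.resolve_right hx

theorem isTimeDirection_of_energy_pos [Nontrivial K] (D : CliffordPairing Q h γ Ω κ τ)
    (hQ : QFNondeg Q) {v : V} (hv : Q v ≠ 0) (r : ℝ)
    (hr : ∀ x, x ≠ 0 → 0 < r * D.energy v x) : IsTimeDirection Q v := by
  obtain ⟨x, hx⟩ := exists_ne (0 : K)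
  have hx0 := hr x hx
  constructor
  · have h1 : γ v x ≠ 0 := fun h0 => by
      have h2 := D.sq v x
      rw [h0, LinearMap.map_zero, eq_comm, smul_eq_zero] at h2
      exact hv (by exact_mod_cast h2.resolve_right hx)
    have h2 := hr _ h1
    rw [D.energy_map, QuadraticMap.polar_self, two_nsmul] at h2
    by_contra! h3
    nlinarith
  · intro u hu huv
    have hmap : ∀ y, D.energy v (γ u y) = Q u * D.energy v y := fun y => by
      rw [D.energy_map, QuadraticMap.polar_comm, huv]; ring
    by_contra! hle
    refine hu (hQ u (D.polar_eq_zero_of_map_eq_zero fun y => ?_))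
    by_contra hy
    have h1 := hr _ hy
    have hy0 : y ≠ 0 := by rintro rfl; simp at hy
    rw [hmap] at h1
    nlinarith [hr y hy0]

/-- In the presence of a basis with exactly one negative vector `e i₀`, the form attached to that
vector is definite. -/
theorem exists_sign_energy_pos [FiniteDimensional ℂ K] [Nontrivial K]
    (D : CliffordPairing Q h γ Ω κ τ) {n : ℕ} (e : Fin n → V)
    (he_span : Submodule.span ℝ (Set.range e) = ⊤)
    (he_orth : ∀ i j, i ≠ j → QuadraticMap.polar Q (e i) (e j) = 0)
    (i₀ : Fin n) (h₀ : Q (e i₀) = -1) (h₁ : ∀ j, j ≠ i₀ → Q (e j) = 1) :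
    ∃ ε : ℝ, (ε = 1 ∨ ε = -1) ∧ ∀ x, x ≠ 0 → 0 < ε * D.energy (e i₀) x := by
  have hunit : ∀ i, (∀ x, γ (e i) (γ (e i) x) = x) ∨ ∀ x, γ (e i) (γ (e i) x) = -x := by
    intro i
    by_cases hi : i = i₀
    · right; intro x; rw [D.sq, hi, h₀]; simp
    · left; intro x; rw [D.sq, h₁ i hi]; simp
  obtain ⟨g, hg, hinv⟩ := SesqForm.exists_invariant_posDef (fun i => γ (e i))
    (fun i j hij x => by rw [D.swap, he_orth i j hij]; simp) hunit Finset.univ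
  set f := D.pairing (e i₀) with hf
  have hfinv : ∀ i x y, f.form (γ (e i) x) (γ (e i) y) = f.form x y := by
    intro i x y
    rw [hf, D.pairing_map]
    by_cases hi : i = i₀
    · rw [hi, QuadraticMap.polar_self, h₀]
      push_cast
      ring
    · rw [he_orth i i₀ hi, h₁ i hi]
      simp
  obtain ⟨a, φ, hφ, hprop⟩ := SesqForm.exists_proportional_vector f g hg
  let N : Submodule ℂ K :=
    { carrier := {y | ∀ x, f.form x y = a * g.form x y}
      add_mem' := fun {y z} hy hz x => by rw [f.add_right, g.add_right, hy, hz]; ring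
      zero_mem' := fun x => by rw [f.zero_right, g.zero_right, mul_zero]
      smul_mem' := fun r y hy x => by rw [f.smul_right, g.smul_right, hy]; ring }
  have hNbasis : ∀ i, ∀ y ∈ N, γ (e i) y ∈ N := by
    intro i y hy x
    obtain ⟨z, rfl⟩ : ∃ z, γ (e i) z = x := by
      rcases hunit i with h2 | h2
      · exact ⟨_, h2 x⟩
      · exact ⟨-γ (e i) x, by rw [LinearMap.map_neg, h2, neg_neg]⟩
    rw [hfinv, hinv i (Finset.mem_univ i)]
    exact hy z
  have hNinv : ∀ v, ∀ y ∈ N, γ v y ∈ N := by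
    intro v y hy
    have hv : v ∈ Submodule.span ℝ (Set.range e) := he_span ▸ Submodule.mem_top
    induction hv using Submodule.span_induction with
    | mem v hv => obtain ⟨i, rfl⟩ := hv; exact hNbasis i y hy
    | zero =>
      have h2 := D.map_smul 0 0 y
      rw [zero_smul, Complex.ofReal_zero, zero_smul] at h2
      rw [h2]
      exact N.zero_mem
    | add u v _ _ hu hv => rw [D.map_add]; exact N.add_mem hu hv
    | smul r v _ hv => rw [D.map_smul]; exact N.smul_mem _ hv
  have hNtop : N = ⊤ := (D.irred N hNinv).resolve_left fun hbot => by
    have : φ ∈ N := hprop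
    rw [hbot] at this
    exact hφ ((Submodule.mem_bot ℂ).1 this)
  have hall : ∀ x y, f.form x y = a * g.form x y := fun x y =>
    (hNtop ▸ Submodule.mem_top : y ∈ N) x
  have ha0 : a ≠ 0 := by
    rintro rfl
    obtain ⟨x, hx⟩ := exists_ne (0 : K)
    refine hx (D.nondeg x fun y => ?_)
    have h2 := hall x (γ (e i₀) (Ω y))
    rw [zero_mul, hf, D.pairing_form, D.sq, h₀, LinearMap.map_smul, D.omega_sq, h.smul_right,
      h.smul_right] at h2
    have hτ : (τ : ℂ) ≠ 0 := by
      rcases D.tau_eq with h3 | h3 <;> rw [h3] <;> simp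
    simpa [D.kappa_ne, hτ] using h2
  have hre : ∀ x, D.energy (e i₀) x = a.re * (g.form x x).re := fun x => by
    rw [energy, ← hf, hall, Complex.mul_re, g.im_self, mul_zero, sub_zero]
  have haim : a.im = 0 := by
    have h2 := f.im_self φ
    rw [hall, Complex.mul_im, g.im_self, mul_zero, zero_add] at h2
    exact (mul_eq_zero.1 h2).resolve_right (hg φ hφ).ne'
  have hare : a.re ≠ 0 := fun h2 => ha0 (Complex.ext h2 haim)
  rcases lt_or_gt_of_ne hare with hlt | hlt
  · refine ⟨-1, Or.inr rfl, fun x hx => ?_⟩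
    rw [hre]
    nlinarith [hg x hx]
  · refine ⟨1, Or.inl rfl, fun x hx => ?_⟩
    rw [hre, one_mul]
    exact mul_pos hlt (hg x hx)

theorem energy_pos_of_neg (D : CliffordPairing Q h γ Ω κ τ) {u : V} {ε : ℝ}
    (hε : ∀ x, x ≠ 0 → 0 < ε * D.energy u x) {v : V} (hv : Q v < 0) {x : K} (hx : x ≠ 0) :
    0 < -QuadraticMap.polar Q v u * (ε * D.energy v x) := by
  have h1 : 0 ≤ ε * D.energy u (γ v x) := by
    by_cases h0 : γ v x = 0
    · rw [h0, D.energy_zero, mul_zero]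
    · exact (hε _ h0).le
  rw [D.energy_map] at h1
  nlinarith [mul_pos_of_neg_of_neg hv (neg_neg_of_pos (hε x hx))]

theorem inverse_form (D : CliffordPairing Q h γ Ω κ τ) {v : V} {W : K →ₗ[ℂ] K} (hv : Q v ≠ 0)
    (hW : ∀ x, W (Ω (γ v x)) = x) (x : K) :
    κ * h.form x (W x) = ((-(τ / Q v) * D.energy v x : ℝ) : ℂ) := by
  have hτ : (τ : ℂ) * τ = 1 := by
    rcases D.tau_eq with h1 | h1 <;> rw [h1] <;> simp
  have hv' : (Q v : ℂ) ≠ 0 := by exact_mod_cast hv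
  have h1 : Ω (γ v (Ω (γ v x))) = -((τ : ℂ) * Q v) • x := by
    rw [D.omega_anti v (Ω (γ v x)), D.omega_sq, LinearMap.map_smul, D.sq, smul_smul, neg_smul]
  have h2 : W x = (-(τ / Q v : ℂ)) • Ω (γ v x) := by
    have h3 := hW (Ω (γ v x))
    rw [h1, LinearMap.map_smul] at h3
    rw [← h3, smul_smul]
    have : -(τ / Q v : ℂ) * -((τ : ℂ) * Q v) = 1 := by
      field_simp
      linear_combination hτ
    rw [this, one_smul]
  rw [h2, h.smul_right]
  have h4 := D.pairing_self v x
  rw [D.pairing_form] at h4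
  push_cast
  rw [← h4]
  ring

theorem ne_zero_of_inverse [Nontrivial K] (D : CliffordPairing Q h γ Ω κ τ) {v : V}
    {W : K →ₗ[ℂ] K} (hW : ∀ x, W (Ω (γ v x)) = x) : Q v ≠ 0 := fun h0 => by
  obtain ⟨x, hx⟩ := exists_ne (0 : K)
  have h1 : ∀ y, γ v y = 0 := fun y => by
    have h2 := hW (γ v y)
    rw [D.sq, h0, Complex.ofReal_zero, zero_smul, LinearMap.map_zero, LinearMap.map_zero] at h2
    exact h2.symm
  have h2 := hW x
  rw [h1, LinearMap.map_zero, LinearMap.map_zero] at h2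
  exact hx h2.symm

theorem isTimeDirection_of_fDefinite [Nontrivial K] (D : CliffordPairing Q h γ Ω κ τ)
    (hQ : QFNondeg Q) {v : V} {W : K →ₗ[ℂ] K} (hW : ∀ x, W (Ω (γ v x)) = x)
    (hdef : FDefinite fun x y => κ * h.form x (W y)) : IsTimeDirection Q v := by
  have hv := D.ne_zero_of_inverse hW
  rcases (fDefinite_iff (D.inverse_form hv hW)).1 hdef with h1 | h1
  · exact D.isTimeDirection_of_energy_pos hQ hv _ h1
  · refine D.isTimeDirection_of_energy_pos hQ hv (τ / Q v) fun x hx => ?_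
    have := h1 x hx
    linarith

/-- The sign of the form `κ (·, (Ω γ(v))⁻¹ ·)` for negative `v`. -/
theorem inverse_energy_pos (D : CliffordPairing Q h γ Ω κ τ) {u : V} {ε : ℝ}
    (hε : ∀ x, x ≠ 0 → 0 < ε * D.energy u x) {v : V} (hv : Q v < 0) {x : K} (hx : x ≠ 0) :
    0 < -QuadraticMap.polar Q v u * (τ * ε * (-(τ / Q v) * D.energy v x)) := by
  have hτ : τ * τ = 1 := by
    rcases D.tau_eq with h1 | h1 <;> rw [h1] <;> norm_num
  have h1 := D.energy_pos_of_neg hε hv hx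
  have h2 : -QuadraticMap.polar Q v u * (τ * ε * (-(τ / Q v) * D.energy v x))
      = (τ * τ) * (-QuadraticMap.polar Q v u * (ε * D.energy v x)) * (-Q v)⁻¹ := by
    field_simp
  rw [h2, hτ, one_mul]
  exact mul_pos h1 (inv_pos.2 (neg_pos.2 hv))

theorem fDefinite_of_neg [Nontrivial K] (D : CliffordPairing Q h γ Ω κ τ) {u : V} {ε : ℝ}
    (hε : ∀ x, x ≠ 0 → 0 < ε * D.energy u x) {v : V} (hv : Q v < 0) {W : K →ₗ[ℂ] K}
    (hW : ∀ x, W (Ω (γ v x)) = x) : FDefinite fun x y => κ * h.form x (W y) := by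
  rw [fDefinite_iff (D.inverse_form hv.ne hW)]
  rcases lt_or_ge 0 (-QuadraticMap.polar Q v u * (τ * ε)) with h1 | h1
  · left
    intro x hx
    have h2 := D.inverse_energy_pos hε hv hx
    rw [← mul_assoc] at h2
    exact (pos_iff_pos_of_mul_pos h2).1 h1
  · right
    intro x hx
    have h2 := D.inverse_energy_pos hε hv hx
    rw [← mul_assoc] at h2
    by_contra! h3
    exact absurd h2 (not_lt.2 (mul_nonpos_of_nonpos_of_nonneg h1 h3))

theorem polar_ne_zero_of_neg [Nontrivial K] (D : CliffordPairing Q h γ Ω κ τ) {u : V} {ε : ℝ}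
    (hε : ∀ x, x ≠ 0 → 0 < ε * D.energy u x) {v : V} (hv : Q v < 0) :
    QuadraticMap.polar Q v u ≠ 0 := fun h0 => by
  obtain ⟨x, hx⟩ := exists_ne (0 : K)
  have h1 := D.energy_pos_of_neg hε hv hx
  rw [h0] at h1
  simp at h1

/-- The two components of the negative cone are distinguished by the sign of the product
with `u`. -/
theorem exists_sign_cone {u : V} (hu : ∀ v, Q v < 0 → QuadraticMap.polar Q v u ≠ 0)
    {Cp Cn : Set V} (hC : IsConeComponentsNeg Q Cp Cn) :
    ∃ s : ℝ, (s = 1 ∨ s = -1) ∧ (∀ v ∈ Cp, 0 < s * QuadraticMap.polar Q v u) ∧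
      ∀ v ∈ Cn, s * QuadraticMap.polar Q v u < 0 := by
  obtain ⟨hunion, -, ⟨p, hp⟩, -, hpp, hnn, -⟩ := hC
  have hmem : ∀ v, v ∈ Cp ∨ v ∈ Cn ↔ Q v < 0 := fun v => by
    rw [← Set.mem_union, hunion, Set.mem_ofPred_eq]
  have hsame : ∀ v w, SameConeNeg Q v w →
      0 < QuadraticMap.polar Q v u * QuadraticMap.polar Q w u := by
    intro v w hvw
    by_contra! hle
    set a := QuadraticMap.polar Q v u with ha
    set b := QuadraticMap.polar Q w u with hb
    have hav : a ≠ 0 := hu v (by simpa using hvw 0 le_rfl zero_le_one)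
    have hsq : 0 < a * a := mul_self_pos.2 hav
    have hD : 0 < a * a - a * b := by linarith
    have hab : a - b ≠ 0 := fun h0 => by
      have : a * a - a * b = a * (a - b) := by ring
      rw [this, h0, mul_zero] at hD
      exact lt_irrefl _ hD
    refine hu _ (hvw (a * a / (a * a - a * b)) (by positivity)
      ((div_le_one hD).2 (by linarith))) ?_
    rw [QuadraticMap.polar_add_left, QuadraticMap.polar_smul_left, QuadraticMap.polar_smul_left,
      ← ha, ← hb, smul_eq_mul, smul_eq_mul]
    field_simp
    ring
  have hQp : Q p < 0 := (hmem p).1 (Or.inl hp)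
  have hnegp : -p ∈ Cn := by
    have h1 : -p ∈ Cp ∨ -p ∈ Cn := (hmem _).2 (by rwa [QuadraticMap.map_neg])
    refine h1.resolve_left fun h2 => ?_
    have h3 := hsame _ _ (hpp _ hp _ h2)
    rw [QuadraticMap.polar_neg_left] at h3
    nlinarith [mul_self_nonneg (QuadraticMap.polar Q p u)]
  have h1 : ∀ v ∈ Cp, 0 < QuadraticMap.polar Q p u * QuadraticMap.polar Q v u :=
    fun v hv => hsame _ _ (hpp _ hp _ hv)
  have h2 : ∀ v ∈ Cn, QuadraticMap.polar Q p u * QuadraticMap.polar Q v u < 0 := fun v hv => by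
    have := hsame _ _ (hnn _ hnegp _ hv)
    rw [QuadraticMap.polar_neg_left] at this
    linarith
  rcases lt_or_gt_of_ne (hu p hQp) with h3 | h3
  · refine ⟨-1, Or.inr rfl, fun v hv => ?_, fun v hv => ?_⟩
    · have := neg_of_mul_pos_right (h1 v hv) h3.le
      linarith
    · have := pos_of_mul_neg_right (h2 v hv) h3.le
      linarith
  · refine ⟨1, Or.inl rfl, fun v hv => ?_, fun v hv => ?_⟩
    · have := pos_of_mul_pos_right (h1 v hv) h3.le
      linarith
    · have := neg_of_mul_neg_right (h2 v hv) h3.le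
      linarith

theorem exists_sign_inverse_form [Nontrivial K] (D : CliffordPairing Q h γ Ω κ τ) {u : V} {ε : ℝ}
    (hε1 : ε = 1 ∨ ε = -1) (hε : ∀ x, x ≠ 0 → 0 < ε * D.energy u x) {Cp Cn : Set V}
    (hC : IsConeComponentsNeg Q Cp Cn) :
    ∃ l : ℝ, (l = 1 ∨ l = -1) ∧ ∀ (v : V) (W : K →ₗ[ℂ] K), (∀ x, W (Ω (γ v x)) = x) →
      Q v < 0 →
      ((FPosDef (fun x y => (l : ℂ) * (κ * h.form x (W y))) ↔ v ∈ Cp)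
        ∧ (FNegDef (fun x y => (l : ℂ) * (κ * h.form x (W y))) ↔ v ∈ Cn)) := by
  obtain ⟨s, hs, hsp, hsn⟩ := exists_sign_cone (fun v hv => D.polar_ne_zero_of_neg hε hv) hC
  refine ⟨-(s * (τ * ε)), ?_, fun v W hW hv => ?_⟩
  · rcases hs with rfl | rfl <;> rcases D.tau_eq with h1 | h1 <;> rcases hε1 with rfl | rfl <;>
      simp [h1]
  have hform : ∀ x, ((-(s * (τ * ε)) : ℝ) : ℂ) * (κ * h.form x (W x))
      = ((-(s * (τ * ε)) * (-(τ / Q v) * D.energy v x) : ℝ) : ℂ) := fun x => by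
    rw [D.inverse_form hv.ne hW, ← Complex.ofReal_mul]
  have hss : s * s = 1 := by rcases hs with rfl | rfl <;> norm_num
  have hsign : ∀ x, x ≠ 0 → 0 < (s * QuadraticMap.polar Q v u) *
      (-(s * (τ * ε)) * (-(τ / Q v) * D.energy v x)) := fun x hx => by
    have h1 := D.inverse_energy_pos hε hv hx
    have h2 : (s * QuadraticMap.polar Q v u) * (-(s * (τ * ε)) * (-(τ / Q v) * D.energy v x))
        = (s * s) * (-QuadraticMap.polar Q v u * (τ * ε * (-(τ / Q v) * D.energy v x))) := by
      ring
    rwa [h2, hss, one_mul]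
  obtain ⟨x₀, hx₀⟩ := exists_ne (0 : K)
  have hmem : v ∈ Cp ∨ v ∈ Cn := by
    rw [← Set.mem_union, hC.1]
    exact hv
  have hpos : v ∈ Cp → ∀ x, x ≠ 0 → 0 < -(s * (τ * ε)) * (-(τ / Q v) * D.energy v x) :=
    fun hvp x hx => (pos_iff_pos_of_mul_pos (hsign x hx)).1 (hsp v hvp)
  have hneg : v ∈ Cn → ∀ x, x ≠ 0 → -(s * (τ * ε)) * (-(τ / Q v) * D.energy v x) < 0 :=
    fun hvn x hx => neg_of_mul_pos_right (hsign x hx) (hsn v hvn).le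
  rw [fPosDef_iff hform, fNegDef_iff hform]
  exact ⟨⟨fun h1 => hmem.resolve_right fun h2 => lt_asymm (h1 x₀ hx₀) (hneg h2 x₀ hx₀), hpos⟩,
    ⟨fun h1 => hmem.resolve_left fun h2 => lt_asymm (h1 x₀ hx₀) (hpos h2 x₀ hx₀), hneg⟩⟩

end CliffordPairing

end CliffordActions

section ComplexCliffordAlgebra

variable (Q : QuadraticForm ℝ V)

theorem ιr_add (v w : V) : ιr Q (v + w) = ιr Q v + ιr Q w := by
  rw [ιr, TensorProduct.tmul_add, map_add]; rfl

theorem ιr_smul (r : ℝ) (v : V) : ιr Q (r • v) = (r : ℂ) • ιr Q v := by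
  rw [ιr, ιr, ← map_smul]
  congr 1
  rw [← TensorProduct.smul_tmul, TensorProduct.smul_tmul', Complex.real_smul, smul_eq_mul]

theorem ιr_mul_self (v : V) : ιr Q v * ιr Q v = algebraMap ℂ (CCl Q) (Q v) := by
  rw [ιr, CliffordAlgebra.ι_sq_scalar, QuadraticForm.baseChange_tmul]
  simp

theorem ιr_mul_add_swap (v w : V) :
    ιr Q v * ιr Q w + ιr Q w * ιr Q v = algebraMap ℂ (CCl Q) (QuadraticMap.polar Q v w : ℝ) := by
  have h1 := ιr_mul_self Q (v + w)
  rw [QuadraticMap.map_add Q, ιr_add] at h1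
  rw [Complex.ofReal_add, Complex.ofReal_add, map_add, map_add, ← ιr_mul_self, ← ιr_mul_self] at h1
  have h2 : (ιr Q v + ιr Q w) * (ιr Q v + ιr Q w)
      = ιr Q v * ιr Q v + ιr Q w * ιr Q w + (ιr Q v * ιr Q w + ιr Q w * ιr Q v) := by
    noncomm_ring
  rw [h2] at h1
  exact add_left_cancel h1

variable {Q}

theorem IsIrreducibleRep.of_ιr {K : Type*} [AddCommGroup K] [Module ℂ K]
    {ρ : CCl Q →ₐ[ℂ] Module.End ℂ K} (hirr : IsIrreducibleRep ρ) (p : Submodule ℂ K)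
    (hp : ∀ v, ∀ x ∈ p, ρ (ιr Q v) x ∈ p) : p = ⊥ ∨ p = ⊤ := by
  refine hirr.2 p fun a => ?_
  induction a using CliffordAlgebra.induction with
  | algebraMap r =>
    intro x hx
    rw [AlgHom.commutes, Module.algebraMap_end_apply]
    exact p.smul_mem r hx
  | ι m =>
    intro x hx
    induction m using TensorProduct.induction_on with
    | zero => rw [map_zero, map_zero]; exact p.zero_mem
    | tmul z v =>
      have h1 : z ⊗ₜ[ℝ] v = z • ((1 : ℂ) ⊗ₜ[ℝ] v) := by
        rw [TensorProduct.smul_tmul', smul_eq_mul, mul_one]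
      rw [h1, map_smul, map_smul]
      exact p.smul_mem z (hp v x hx)
    | add m m' hm hm' => rw [map_add, map_add]; exact p.add_mem hm hm'
  | mul a b ha hb =>
    intro x hx
    rw [map_mul]
    exact ha _ (hb x hx)
  | add a b ha hb =>
    intro x hx
    rw [map_add]
    exact p.add_mem (ha x hx) (hb x hx)

theorem RealStructure.toFun_list_prod (c : RealStructure Q) (l : List (CCl Q))
    (hl : ∀ a ∈ l, c.toFun a = a) : c.toFun l.prod = l.prod := by
  induction l with
  | nil => exact c.map_one'
  | cons a l ih =>
    rw [List.prod_cons, c.map_mul', hl a List.mem_cons_self,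
      ih fun b hb => hl b (List.mem_cons_of_mem _ hb)]

variable {n : ℕ} {e : Fin n → V}

theorem ιr_anticommute (he_orth : ∀ i j, i ≠ j → QuadraticMap.polar Q (e i) (e j) = 0)
    (i j : Fin n) (hij : i ≠ j) : ιr Q (e i) * ιr Q (e j) = -(ιr Q (e j) * ιr Q (e i)) := by
  have h1 := ιr_mul_add_swap Q (e i) (e j)
  rw [he_orth i j hij, Complex.ofReal_zero, map_zero] at h1
  exact eq_neg_of_add_eq_zero_left h1

theorem volume_mul_ιr (hn : Even n) (he_span : Submodule.span ℝ (Set.range e) = ⊤)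
    (he_orth : ∀ i j, i ≠ j → QuadraticMap.polar Q (e i) (e j) = 0) (v : V) :
    (List.ofFn fun i => ιr Q (e i)).prod * ιr Q v
      = -(ιr Q v * (List.ofFn fun i => ιr Q (e i)).prod) := by
  have hv : v ∈ Submodule.span ℝ (Set.range e) := he_span ▸ Submodule.mem_top
  induction hv using Submodule.span_induction with
  | mem v hv =>
    obtain ⟨i, rfl⟩ := hv
    rw [List.ofFn_eq_map, list_prod_mul_of_anticommute (fun i => ιr Q (e i))
      (ιr_anticommute he_orth) i _ (List.nodup_finRange n), if_pos (List.mem_finRange i),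
      List.length_finRange, hn.add_one.neg_one_pow, neg_one_mul]
  | zero =>
    have h1 : ιr Q 0 = 0 := by simpa using ιr_smul Q 0 0
    rw [h1, mul_zero, zero_mul, neg_zero]
  | add u v _ _ hu hv => rw [ιr_add, mul_add, hu, hv, add_mul, neg_add]
  | smul r v _ hv => rw [ιr_smul, mul_smul_comm, hv, smul_mul_assoc, smul_neg]

theorem toFun_reverse_volume {c : RealStructure Q} (hc : IsCanonicalC c)
    (he_orth : ∀ i j, i ≠ j → QuadraticMap.polar Q (e i) (e j) = 0) :
    c.toFun (CliffordAlgebra.reverse (List.ofFn fun i => ιr Q (e i)).prod)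
      = (-1) ^ (n.choose 2) * (List.ofFn fun i => ιr Q (e i)).prod := by
  have h1 : CliffordAlgebra.reverse (List.ofFn fun i => ιr Q (e i)).prod
      = (List.ofFn fun i => ιr Q (e i)).reverse.prod := by
    have h2 := CliffordAlgebra.reverse_prod_map_ι (Q := Q.baseChange ℂ)
      (List.ofFn fun i => (1 : ℂ) ⊗ₜ[ℝ] e i)
    rw [List.map_ofFn] at h2
    exact h2
  rw [h1, c.toFun_list_prod, List.ofFn_eq_map, list_reverse_prod_of_anticommute
    (fun i => ιr Q (e i)) (ιr_anticommute he_orth) _ (List.nodup_finRange n),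
    List.length_finRange]
  intro a ha
  rw [List.mem_reverse, List.mem_ofFn] at ha
  obtain ⟨i, rfl⟩ := ha
  exact hc _

theorem volume_mul_self (he_orth : ∀ i j, i ≠ j → QuadraticMap.polar Q (e i) (e j) = 0)
    (he_unit : ∀ i, Q (e i) = 1 ∨ Q (e i) = -1) :
    ∃ τ : ℝ, (τ = 1 ∨ τ = -1) ∧
      (List.ofFn fun i => ιr Q (e i)).prod * (List.ofFn fun i => ιr Q (e i)).prod
        = algebraMap ℂ (CCl Q) τ := by
  have h1 : (List.ofFn fun i => ιr Q (e i)).reverse.prod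
      = (-1) ^ (n.choose 2) * (List.ofFn fun i => ιr Q (e i)).prod := by
    rw [List.ofFn_eq_map, list_reverse_prod_of_anticommute
      (fun i => ιr Q (e i)) (ιr_anticommute he_orth) _ (List.nodup_finRange n),
      List.length_finRange]
  have h2 := list_prod_mul_reverse_prod (l := List.ofFn fun i => ιr Q (e i)) (by
    intro a ha
    rw [List.mem_ofFn] at ha
    obtain ⟨i, rfl⟩ := ha
    rw [ιr_mul_self]
    rcases he_unit i with h3 | h3 <;> simp [h3])
  rw [h1] at h2
  rcases neg_one_pow_eq_or (CCl Q) (n.choose 2) with h3 | h3 <;> rw [h3] at h2 <;>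
    rcases h2 with h2 | h2
  · exact ⟨1, Or.inl rfl, by simpa using h2⟩
  · exact ⟨-1, Or.inr rfl, by simpa using h2⟩
  · exact ⟨-1, Or.inr rfl, by simpa [neg_eq_iff_eq_neg] using h2⟩
  · exact ⟨1, Or.inl rfl, by simpa using h2⟩

/-- A compatible irreducible representation and a volume element yield a `CliffordPairing`, for
`κ = 1` or `κ = i` according to the parity of `n.choose 2`. -/
theorem exists_cliffordPairing (hn : Even n) {c : RealStructure Q} (hc : IsCanonicalC c)
    {K : Type*} [AddCommGroup K] [Module ℂ K]
    {ρ : CCl Q →ₐ[ℂ] Module.End ℂ K} (hirr : IsIrreducibleRep ρ)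
    {h : SesqForm K} (hnd : h.Nondeg) (hcompat : Compat c ρ h)
    (he_span : Submodule.span ℝ (Set.range e) = ⊤)
    (he_orth : ∀ i j, i ≠ j → QuadraticMap.polar Q (e i) (e j) = 0)
    (he_unit : ∀ i, Q (e i) = 1 ∨ Q (e i) = -1)
    {κ : ℂ} (hκ : κ ≠ 0) (hκn : -((-1) ^ (n.choose 2) * starRingEnd ℂ κ) = κ) :
    ∃ τ : ℝ, CliffordPairing Q h (fun v => ρ (ιr Q v))
      (ρ (List.ofFn fun i => ιr Q (e i)).prod) κ τ := by
  obtain ⟨τ, hτ, hsq⟩ := volume_mul_self he_orth he_unit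
  have hanti := volume_mul_ιr hn he_span he_orth
  have hrev := toFun_reverse_volume hc he_orth
  set ω := (List.ofFn fun i => ιr Q (e i)).prod
  have hself : ∀ v x y, h.form (ρ (ιr Q v) x) y = h.form x (ρ (ιr Q v) y) := fun v x y => by
    rw [hcompat, ιr, CliffordAlgebra.reverse_ι]
    exact congrArg (fun a => h.form x (ρ a y)) (hc v)
  have hanti' : ∀ v x, ρ ω (ρ (ιr Q v) x) = -ρ (ιr Q v) (ρ ω x) := fun v x => by
    rw [← Module.End.mul_apply, ← map_mul, hanti, map_neg, map_mul]
    rfl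
  have hω : ∀ x y, h.form (ρ ω x) y = (-1) ^ (n.choose 2) * h.form x (ρ ω y) := fun x y => by
    rw [hcompat, hrev]
    rcases neg_one_pow_eq_or (CCl Q) (n.choose 2) with h3 | h3
    all_goals
      rcases Nat.even_or_odd (n.choose 2) with h4 | h4
      all_goals simp [h4.neg_one_pow, h.neg_right]
  refine ⟨τ, ⟨fun v w x => ?_, fun r v x => ?_, fun v x => ?_, fun v w x => ?_, hself,
    hirr.of_ιr, hnd, hanti', fun x => ?_, hτ, hκ, fun v x y => ?_⟩⟩
  · simp only [ιr_add, map_add, LinearMap.add_apply]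
  · simp only [ιr_smul, map_smul, LinearMap.smul_apply]
  · rw [← Module.End.mul_apply, ← map_mul, ιr_mul_self, AlgHom.commutes,
      Module.algebraMap_end_apply]
  · rw [eq_sub_iff_add_eq, ← Module.End.mul_apply, ← map_mul, ← Module.End.mul_apply, ← map_mul,
      ← LinearMap.add_apply, ← map_add, ιr_mul_add_swap, AlgHom.commutes,
      Module.algebraMap_end_apply]
  · rw [← Module.End.mul_apply, ← map_mul, hsq, AlgHom.commutes, Module.algebraMap_end_apply]
  · rw [map_mul, ← h.herm, hω, hself, ← neg_neg (ρ (ιr Q v) (ρ ω x)), ← hanti', h.neg_right]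
    linear_combination (-h.form y (ρ ω (ρ (ιr Q v) x))) * hκn

/-- The characterization of Lorentzian signature, for a factor `κ` that makes the forms
`κ (·, ρ(ω v)⁻¹ ·)` hermitian. -/
theorem lorentzian_iff_exists_fDefinite (hn : Even n) (hQ : QFNondeg Q) {c : RealStructure Q}
    (hc : IsCanonicalC c) {K : Type*} [AddCommGroup K] [Module ℂ K] [FiniteDimensional ℂ K]
    {ρ : CCl Q →ₐ[ℂ] Module.End ℂ K} (hirr : IsIrreducibleRep ρ)
    {h : SesqForm K} (hnd : h.Nondeg) (hcompat : Compat c ρ h)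
    (he_indep : LinearIndependent ℝ e)
    (he_span : Submodule.span ℝ (Set.range e) = ⊤)
    (he_orth : ∀ i j, i ≠ j → QuadraticMap.polar Q (e i) (e j) = 0)
    (he_unit : ∀ i, Q (e i) = 1 ∨ Q (e i) = -1)
    {ω : CCl Q} (hω : ω = (List.ofFn fun i => ιr Q (e i)).prod)
    {κ : ℂ} (hκ : κ ≠ 0) (hκn : -((-1) ^ (n.choose 2) * starRingEnd ℂ κ) = κ) :
    (HasSignature Q (n - 1) 1
        ↔ ∃ (v : V) (w : CCl Q), w * (ω * ιr Q v) = 1 ∧ (ω * ιr Q v) * w = 1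
            ∧ FDefinite (fun ψ φ : K => κ * h.form ψ (ρ w φ)))
      ∧ (HasSignature Q (n - 1) 1 →
          (∀ (v : V) (w : CCl Q), w * (ω * ιr Q v) = 1 → (ω * ιr Q v) * w = 1 →
            (FDefinite (fun ψ φ : K => κ * h.form ψ (ρ w φ)) ↔ Q v < 0))
          ∧ (∀ Cp Cn : Set V, IsConeComponentsNeg Q Cp Cn →
              ∃ l : ℝ, (l = 1 ∨ l = -1)
                ∧ ∀ (v : V) (w : CCl Q), w * (ω * ιr Q v) = 1 → (ω * ιr Q v) * w = 1 →
                    Q v < 0 →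
                    ((FPosDef (fun ψ φ : K => (l : ℂ) * (κ * h.form ψ (ρ w φ))) ↔ v ∈ Cp)
                    ∧ (FNegDef (fun ψ φ : K => (l : ℂ) * (κ * h.form ψ (ρ w φ)))
                      ↔ v ∈ Cn)))) := by
  obtain ⟨τ, D⟩ := exists_cliffordPairing hn hc hirr hnd hcompat he_span he_orth he_unit hκ hκn
  rw [← hω] at D
  have : Nontrivial K := by
    obtain ⟨x, hx⟩ := hirr.1
    exact ⟨x, 0, hx⟩
  have hinv : ∀ (v : V) (w : CCl Q), w * (ω * ιr Q v) = 1 →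
      ∀ x, ρ w (ρ ω (ρ (ιr Q v) x)) = x := fun v w hw x => by
    have h1 := LinearMap.congr_fun (congrArg ρ hw) x
    simpa only [map_mul, map_one, Module.End.mul_apply, Module.End.one_apply] using h1
  have hsig : HasSignature Q (n - 1) 1 → ∃ i₀, Q (e i₀) = -1 ∧ ∀ j, j ≠ i₀ → Q (e j) = 1 :=
    fun hs => by
      obtain ⟨v, hv⟩ := hs.exists_isTimeDirection
      exact hv.exists_unique_negative e he_span he_orth he_unit
  refine ⟨⟨fun hs => ?_, ?_⟩, fun hs => ⟨fun v w hw _ => ⟨fun hdef => ?_, fun hv => ?_⟩,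
    fun Cp Cn hC => ?_⟩⟩
  · obtain ⟨i₀, h₀, h₁⟩ := hsig hs
    obtain ⟨ε, -, hε⟩ := D.exists_sign_energy_pos e he_span he_orth i₀ h₀ h₁
    obtain ⟨t, ht, hω2⟩ := volume_mul_self (Q := Q) he_orth he_unit
    rw [← hω, Algebra.algebraMap_eq_smul_one] at hω2
    have ht2 : (t : ℂ) * t = 1 := by
      rcases ht with h2 | h2 <;> simp [h2]
    have hs0 : ιr Q (e i₀) * ιr Q (e i₀) = -1 := by rw [ιr_mul_self, h₀]; simp
    have hleft : -((t : ℂ) • (ιr Q (e i₀) * ω)) * (ω * ιr Q (e i₀)) = 1 := by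
      rw [neg_mul, smul_mul_assoc, mul_assoc, ← mul_assoc ω, hω2, smul_mul_assoc, one_mul,
        mul_smul_comm, hs0, smul_smul, ht2, one_smul, neg_neg]
    have hright : ω * ιr Q (e i₀) * -((t : ℂ) • (ιr Q (e i₀) * ω)) = 1 := by
      rw [mul_neg, mul_smul_comm, mul_assoc, ← mul_assoc (ιr Q (e i₀)), hs0, neg_one_mul, mul_neg,
        hω2, smul_neg, smul_smul, ht2, one_smul, neg_neg]
    exact ⟨e i₀, _, hleft, hright, D.fDefinite_of_neg hε (by rw [h₀]; norm_num)
      (hinv _ _ hleft)⟩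
  · rintro ⟨v, w, hw, -, hdef⟩
    obtain ⟨i₀, h₀, h₁⟩ := (D.isTimeDirection_of_fDefinite hQ (hinv v w hw)
      hdef).exists_unique_negative e he_span he_orth he_unit
    exact hasSignature_of_unique_negative e he_indep he_span he_orth i₀ h₀ h₁
  · exact (D.isTimeDirection_of_fDefinite hQ (hinv v w hw) hdef).1
  · obtain ⟨i₀, h₀, h₁⟩ := hsig hs
    obtain ⟨ε, -, hε⟩ := D.exists_sign_energy_pos e he_span he_orth i₀ h₀ h₁
    exact D.fDefinite_of_neg hε hv (hinv v w hw)
  · obtain ⟨i₀, h₀, h₁⟩ := hsig hs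
    obtain ⟨ε, hε1, hε⟩ := D.exists_sign_energy_pos e he_span he_orth i₀ h₀ h₁
    obtain ⟨l, hl, hlv⟩ := D.exists_sign_inverse_form hε1 hε hC
    exact ⟨l, hl, fun v w hw _ hv => hlv v (ρ w) (hinv v w hw) hv⟩

end ComplexCliffordAlgebra

/-- With `ω` a volume element: for `n ≡ 2, 6 (mod 8)`, `Q` is Lorentzian
iff `(·, ρ(ωv)⁻¹·)` is definite for some `v ∈ V` with `ωv` invertible; for `n ≡ 0, 4 (mod 8)`,
`Q` is Lorentzian iff `(·, iρ(ωv)⁻¹·)` is definite for some `v ∈ V`. Moreover, in the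
Lorentzian case the relevant form is definite exactly for `v` in the open light cone `C`,
and a single sign `λ = ±1` sorts `C₊` from `C₋`. -/
theorem statement17 [FiniteDimensional ℝ V] (Q : QuadraticForm ℝ V)
    (hdim : Even (Module.finrank ℝ V)) (hQ : QFNondeg Q)
    (c : RealStructure Q) (hc : IsCanonicalC c)
    {K : Type*} [AddCommGroup K] [Module ℂ K] [FiniteDimensional ℂ K]
    (ρ : CCl Q →ₐ[ℂ] Module.End ℂ K) (hirr : IsIrreducibleRep ρ)
    (h : SesqForm K) (hnd : h.Nondeg) (hcompat : Compat c ρ h)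
    -- (e i) is a pseudo-orthonormal basis of V and ω the associated volume element
    (e : Fin (Module.finrank ℝ V) → V)
    (he_indep : LinearIndependent ℝ e)
    (he_span : Submodule.span ℝ (Set.range e) = ⊤)
    (he_orth : ∀ i j, i ≠ j → QuadraticMap.polar Q (e i) (e j) = 0)
    (he_unit : ∀ i, Q (e i) = 1 ∨ Q (e i) = -1)
    (ω : CCl Q) (hω : ω = (List.ofFn fun i => ιr Q (e i)).prod) :
    -- case n ≡ 2, 6 (mod 8)
    ((Module.finrank ℝ V % 8 = 2 ∨ Module.finrank ℝ V % 8 = 6) →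
      (HasSignature Q (Module.finrank ℝ V - 1) 1
        ↔ ∃ (v : V) (w : CCl Q), w * (ω * ιr Q v) = 1 ∧ (ω * ιr Q v) * w = 1
            ∧ FDefinite (fun ψ φ : K => h.form ψ (ρ w φ)))
      ∧ (HasSignature Q (Module.finrank ℝ V - 1) 1 →
          (∀ (v : V) (w : CCl Q), w * (ω * ιr Q v) = 1 → (ω * ιr Q v) * w = 1 →
            (FDefinite (fun ψ φ : K => h.form ψ (ρ w φ)) ↔ Q v < 0))
          ∧ (∀ Cp Cn : Set V, IsConeComponentsNeg Q Cp Cn →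
              ∃ l : ℝ, (l = 1 ∨ l = -1)
                ∧ ∀ (v : V) (w : CCl Q), w * (ω * ιr Q v) = 1 → (ω * ιr Q v) * w = 1 →
                    Q v < 0 →
                    ((FPosDef (fun ψ φ : K => (l : ℂ) * h.form ψ (ρ w φ)) ↔ v ∈ Cp)
                    ∧ (FNegDef (fun ψ φ : K => (l : ℂ) * h.form ψ (ρ w φ)) ↔ v ∈ Cn)))))
    -- case n ≡ 0, 4 (mod 8)
    ∧ ((Module.finrank ℝ V % 8 = 0 ∨ Module.finrank ℝ V % 8 = 4) →
      (HasSignature Q (Module.finrank ℝ V - 1) 1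
        ↔ ∃ (v : V) (w : CCl Q), w * (ω * ιr Q v) = 1 ∧ (ω * ιr Q v) * w = 1
            ∧ FDefinite (fun ψ φ : K => h.form ψ (ρ (Complex.I • w) φ)))
      ∧ (HasSignature Q (Module.finrank ℝ V - 1) 1 →
          (∀ (v : V) (w : CCl Q), w * (ω * ιr Q v) = 1 → (ω * ιr Q v) * w = 1 →
            (FDefinite (fun ψ φ : K => h.form ψ (ρ (Complex.I • w) φ)) ↔ Q v < 0))
          ∧ (∀ Cp Cn : Set V, IsConeComponentsNeg Q Cp Cn →
              ∃ l : ℝ, (l = 1 ∨ l = -1)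
                ∧ ∀ (v : V) (w : CCl Q), w * (ω * ιr Q v) = 1 → (ω * ιr Q v) * w = 1 →
                    Q v < 0 →
                    ((FPosDef (fun ψ φ : K =>
                        (l : ℂ) * h.form ψ (ρ (Complex.I • w) φ)) ↔ v ∈ Cp)
                    ∧ (FNegDef (fun ψ φ : K =>
                        (l : ℂ) * h.form ψ (ρ (Complex.I • w) φ)) ↔ v ∈ Cn))))) := by
  refine ⟨fun hn => ?_, fun hn => ?_⟩
  · have hodd : Odd ((Module.finrank ℝ V).choose 2) := by
      obtain ⟨m, hm⟩ : ∃ m, Module.finrank ℝ V = 4 * m + 2 := ⟨Module.finrank ℝ V / 4, by omega⟩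
      rw [hm, Nat.choose_two_right]
      refine ⟨4 * m * m + 3 * m, Nat.div_eq_of_eq_mul_left two_pos ?_⟩
      rw [show 4 * m + 2 - 1 = 4 * m + 1 by omega]
      ring
    have key := lorentzian_iff_exists_fDefinite hdim hQ hc hirr hnd hcompat he_indep he_span
      he_orth he_unit hω (κ := 1) one_ne_zero (by rw [hodd.neg_one_pow]; simp)
    simpa only [one_mul] using key
  · have heven : Even ((Module.finrank ℝ V).choose 2) := by
      obtain ⟨m, hm⟩ : ∃ m, Module.finrank ℝ V = 4 * m := ⟨Module.finrank ℝ V / 4, by omega⟩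
      rw [hm, Nat.choose_two_right, mul_assoc]
      exact ⟨m * (4 * m - 1), Nat.div_eq_of_eq_mul_left two_pos (by ring)⟩
    have key := lorentzian_iff_exists_fDefinite hdim hQ hc hirr hnd hcompat he_indep he_span
      he_orth he_unit hω (κ := Complex.I) Complex.I_ne_zero (by rw [heven.neg_one_pow]; simp)
    simpa only [map_smul, LinearMap.smul_apply, h.smul_right] using key
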